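/- For a convex n-gon (n ≥ 3), the number of sets of i pairwise non-crossing diagonals equals (1/(i+1)) · C(n-3, i) · C(n+i-1, i) (Cayley's formula). -/

import Mathlib

/-- A diagonal of a convex `n`-gon with vertices `0, 1, …, n-1` (in cyclic order),
encoded as an ordered pair `(p.1, p.2)` with `p.1 < p.2`: the two endpoints must be
non-adjacent in the cyclic order. -/
def IsDiagonal (n : ℕ) (p : Fin n × Fin n) : Prop :=
  p.1 < p.2 ∧ (p.2 : ℕ) ≠ (p.1 : ℕ) + 1 ∧ ¬((p.1 : ℕ) = 0 ∧ (p.2 : ℕ) = n - 1)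

/-- Two diagonals `{a,b}` and `{c,d}` (with `a < b`, `c < d`) of a convex polygon cross
(intersect in the interior) iff exactly one of `c, d` lies strictly between `a` and `b`. -/
def Crosses {n : ℕ} (p q : Fin n × Fin n) : Prop :=
  (p.1 < q.1 ∧ q.1 < p.2 ∧ p.2 < q.2) ∨ (q.1 < p.1 ∧ p.1 < q.2 ∧ q.2 < p.2)

/-- The number of sets of `i` pairwise non-crossing diagonals of a convex `n`-gon. -/
noncomputable def numNonCrossing (n i : ℕ) : ℕ :=
  Nat.card {S : Finset (Fin n × Fin n) //
    S.card = i ∧ (∀ p ∈ S, IsDiagonal n p) ∧ ∀ p ∈ S, ∀ q ∈ S, ¬ Crosses p q}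

open Finset in
/-- Pairs of a subset `C` of size `s` of `{0} ∪ W` and an `r`-subset of `W ∪ {x}` lying weakly
below `C` are counted by a single binomial coefficient. -/
theorem sum_powersetCard_choose_card_le (r s : ℕ) (W : Finset ℕ) :
    ∀ x : ℕ, (∀ w ∈ W, 0 < w ∧ w < x) → 0 < x →
      ∑ C ∈ powersetCard s (insert 0 W), (#{c ∈ insert x W | ∀ b ∈ C, c ≤ b}).choose r =
        (#W + 1).choose (s + r) := by
  induction W using Finset.induction_on_max generalizing s with
  | empty =>
    intro x _ hx
    rcases s with _ | _ | s
    · simp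
    · rcases r with _ | r
      · simp [powersetCard_one]
      · simp [powersetCard_one, filter_singleton, hx.ne', Nat.choose_eq_zero_of_lt]
    · rw [powersetCard_eq_empty.2 (by simp)]
      rw [sum_empty, Nat.choose_eq_zero_of_lt (by simp; omega)]
  | insert y W hy ih =>
    intro x hW hx
    have hy0 : 0 < y := (hW y (mem_insert_self _ _)).1
    have hyx : y < x := (hW y (mem_insert_self _ _)).2
    have hyW : y ∉ W := fun h => (hy y h).false
    have hxW : x ∉ insert y W := fun h => (hW x h).2.false
    have ih' := fun s => ih s y (fun w hw => ⟨(hW w (mem_insert_of_mem hw)).1, hy w hw⟩) hy0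
    rcases s with _ | s
    · simp [card_insert_of_notMem hxW]
    · have hyU : y ∉ insert 0 W := by simp [hyW, hy0.ne']
      have hle : ∀ b ∈ insert 0 W, b < y := by
        intro b hb
        rcases mem_insert.1 hb with rfl | hb
        · exact hy0
        · exact hy b hb
      rw [Finset.insert_comm 0 y, powersetCard_succ_insert hyU, sum_union, sum_image]
      · rw [card_insert_of_notMem hyW, show s + 1 + r = (s + r) + 1 by ring, Nat.choose_succ_succ,
          ← ih' s, show (s + r).succ = s + 1 + r by grind, ← ih' (s + 1), add_comm]
        congr 1
        · refine sum_congr rfl fun C hC => ?_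
          congr 2
          ext c
          simp only [mem_filter, mem_insert, forall_eq_or_imp]
          constructor
          · rintro ⟨hc, h1, h2⟩
            refine ⟨?_, h2⟩
            rcases hc with rfl | hc
            · omega
            · exact hc
          · rintro ⟨hc, h2⟩
            refine ⟨Or.inr hc, ?_, h2⟩
            rcases hc with rfl | hc
            · exact le_rfl
            · exact (hy c hc).le
        · refine sum_congr rfl fun C hC => ?_
          congr 2
          ext c
          simp only [mem_filter, mem_insert]
          refine and_congr_left fun h => ⟨fun hc => ?_, Or.inr⟩
          rcases hc with rfl | hc
          · obtain ⟨hCs, hCc⟩ := mem_powersetCard.1 hC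
            obtain ⟨b, hb⟩ := card_pos.1 (by omega : 0 < #C)
            have := h b hb
            have := hle b (hCs hb)
            omega
          · exact hc
      · intro C hC C' hC' h
        have h1 : y ∉ C := fun h => hyU ((mem_powersetCard.1 hC).1 h)
        have h2 : y ∉ C' := fun h => hyU ((mem_powersetCard.1 hC').1 h)
        rw [← erase_insert h1, ← erase_insert h2, h]
      · rw [Finset.disjoint_left]
        intro C hC hC'
        obtain ⟨C', _, rfl⟩ := mem_image.1 hC'
        exact hyU ((mem_powersetCard.1 hC).1 (mem_insert_self _ _))

/-- Sets of pairwise non-crossing arcs `(a, b)` with `a + 2 ≤ b < m`. -/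
def IsArcSystem (m : ℕ) (D : Finset (ℕ × ℕ)) : Prop :=
  (∀ p ∈ D, p.1 + 2 ≤ p.2 ∧ p.2 < m) ∧
    ∀ p ∈ D, ∀ q ∈ D, ¬ (p.1 < q.1 ∧ q.1 < p.2 ∧ p.2 < q.2)

instance (m : ℕ) : DecidablePred (IsArcSystem m) := fun D => by
  unfold IsArcSystem
  infer_instance

/-- The finite set of all arc systems on `m` vertices. -/
noncomputable def arcSystems (m : ℕ) : Finset (Finset (ℕ × ℕ)) :=
  {D ∈ (Finset.range m ×ˢ Finset.range m).powerset | IsArcSystem m D}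

theorem mem_arcSystems {m : ℕ} {D : Finset (ℕ × ℕ)} : D ∈ arcSystems m ↔ IsArcSystem m D := by
  rw [arcSystems, Finset.mem_filter, Finset.mem_powerset, and_iff_right_iff_imp]
  intro h p hp
  have := h.1 p hp
  simp only [Finset.mem_product, Finset.mem_range]
  omega

/-- The vertices in `{1, …, m - 2}` that lie strictly below no arc of `D`. -/
def innerVisible (m : ℕ) (D : Finset (ℕ × ℕ)) : Finset ℕ :=
  {c ∈ Finset.Ico 1 (m - 1) | ∀ p ∈ D, ¬ (p.1 < c ∧ c < p.2)}

theorem mem_innerVisible {m : ℕ} {D : Finset (ℕ × ℕ)} {c : ℕ} :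
    c ∈ innerVisible m D ↔ (1 ≤ c ∧ c < m - 1) ∧ ∀ p ∈ D, ¬ (p.1 < c ∧ c < p.2) := by
  simp [innerVisible]

/-- Join the new vertex `m` to the vertices in `C`. -/
def addArcs (m : ℕ) (D : Finset (ℕ × ℕ)) (C : Finset ℕ) : Finset (ℕ × ℕ) :=
  D ∪ C.image fun c => (c, m)

theorem mem_addArcs {m : ℕ} {D : Finset (ℕ × ℕ)} {C : Finset ℕ} {p : ℕ × ℕ} :
    p ∈ addArcs m D C ↔ p ∈ D ∨ p.1 ∈ C ∧ p.2 = m := by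
  rcases p with ⟨a, b⟩
  simp [addArcs, eq_comm]

theorem card_addArcs {m : ℕ} {D : Finset (ℕ × ℕ)} (hD : IsArcSystem m D) (C : Finset ℕ) :
    (addArcs m D C).card = D.card + C.card := by
  rw [addArcs, Finset.card_union_of_disjoint, Finset.card_image_of_injective]
  · intro a b h
    exact congrArg Prod.fst h
  · rw [Finset.disjoint_left]
    intro p hp hp'
    obtain ⟨c, _, rfl⟩ := Finset.mem_image.1 hp'
    exact (hD.1 _ hp).2.false

theorem innerVisible_addArcs {m : ℕ} (hm : 2 ≤ m) {D : Finset (ℕ × ℕ)} (hD : IsArcSystem m D)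
    (C : Finset ℕ) :
    innerVisible (m + 1) (addArcs m D C) =
      {c ∈ insert (m - 1) (innerVisible m D) | ∀ b ∈ C, c ≤ b} := by
  ext c
  simp only [mem_innerVisible, Finset.mem_filter, Finset.mem_insert, mem_addArcs]
  constructor
  · rintro ⟨hc, h⟩
    refine ⟨?_, fun b hb => ?_⟩
    · by_cases h' : c = m - 1
      · exact Or.inl h'
      · exact Or.inr ⟨by omega, fun p hp => h p (Or.inl hp)⟩
    · have := h (b, m) (Or.inr ⟨hb, rfl⟩)
      dsimp only at this
      omega
  · rintro ⟨hc, h⟩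
    refine ⟨by omega, ?_⟩
    rintro p (hp | ⟨hp, hpm⟩)
    · rcases hc with rfl | hc
      · have := hD.1 p hp
        omega
      · exact hc.2 p hp
    · have := h _ hp
      omega

theorem isArcSystem_addArcs {m : ℕ} (hm : 2 ≤ m) {D : Finset (ℕ × ℕ)} (hD : IsArcSystem m D)
    {C : Finset ℕ} (hC : C ⊆ insert 0 (innerVisible m D)) : IsArcSystem (m + 1) (addArcs m D C) := by
  have hC' : ∀ c ∈ C, c < m - 1 ∧ ∀ p ∈ D, ¬ (p.1 < c ∧ c < p.2) := by
    intro c hc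
    rcases Finset.mem_insert.1 (hC hc) with rfl | h
    · exact ⟨by omega, fun p _ => by omega⟩
    · exact ⟨(mem_innerVisible.1 h).1.2, (mem_innerVisible.1 h).2⟩
  constructor
  · intro p hp
    rcases mem_addArcs.1 hp with hp | ⟨hp, hpm⟩
    · have := hD.1 p hp
      omega
    · have := hC' _ hp
      omega
  · intro p hp q hq
    rcases mem_addArcs.1 hp with hp | ⟨hp, hpm⟩ <;> rcases mem_addArcs.1 hq with hq | ⟨hq, hqm⟩
    · exact hD.2 p hp q hq
    · have := (hC' _ hq).2 p hp
      omega
    · have := hD.1 q hq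
      omega
    · omega

theorem sum_arcSystems_succ {m : ℕ} (hm : 2 ≤ m) (f : Finset (ℕ × ℕ) → ℕ) :
    ∑ D ∈ arcSystems (m + 1), f D =
      ∑ D ∈ arcSystems m, ∑ C ∈ (insert 0 (innerVisible m D)).powerset, f (addArcs m D C) := by
  rw [Finset.sum_sigma']
  symm
  refine Finset.sum_bij' (fun x _ => addArcs m x.1 x.2)
    (fun D _ => ⟨{p ∈ D | p.2 < m}, ({p ∈ D | p.2 = m} : Finset (ℕ × ℕ)).image Prod.fst⟩)
    ?_ ?_ ?_ ?_ (fun _ _ => rfl)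
  · rintro ⟨D, C⟩ h
    simp only [Finset.mem_sigma, mem_arcSystems, Finset.mem_powerset] at h ⊢
    exact isArcSystem_addArcs hm h.1 h.2
  · intro D h
    rw [mem_arcSystems] at h
    simp only [Finset.mem_sigma, mem_arcSystems, Finset.mem_powerset]
    refine ⟨⟨fun p hp => ?_, fun p hp q hq => ?_⟩, ?_⟩
    · rw [Finset.mem_filter] at hp
      exact ⟨(h.1 p hp.1).1, hp.2⟩
    · exact h.2 p (Finset.mem_filter.1 hp).1 q (Finset.mem_filter.1 hq).1
    · intro c hc
      obtain ⟨q, hq, rfl⟩ := Finset.mem_image.1 hc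
      rw [Finset.mem_filter] at hq
      rw [Finset.mem_insert, mem_innerVisible]
      by_cases h0 : q.1 = 0
      · exact Or.inl h0
      · have := h.1 q hq.1
        refine Or.inr ⟨by omega, fun p hp => ?_⟩
        rw [Finset.mem_filter] at hp
        have := h.2 p hp.1 q hq.1
        omega
  · rintro ⟨D, C⟩ h
    simp only [Finset.mem_sigma, mem_arcSystems, Finset.mem_powerset] at h
    have h1 : ({p ∈ addArcs m D C | p.2 < m} : Finset (ℕ × ℕ)) = D := by
      ext p
      rw [Finset.mem_filter, mem_addArcs]
      constructor
      · rintro ⟨hp | hp, h'⟩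
        · exact hp
        · omega
      · exact fun hp => ⟨Or.inl hp, (h.1.1 p hp).2⟩
    have h2 : ({p ∈ addArcs m D C | p.2 = m} : Finset (ℕ × ℕ)).image Prod.fst = C := by
      ext c
      simp only [Finset.mem_image, Finset.mem_filter, mem_addArcs]
      constructor
      · rintro ⟨p, ⟨hp | hp, h'⟩, rfl⟩
        · have := h.1.1 p hp
          omega
        · exact hp.1
      · exact fun hc => ⟨(c, m), ⟨Or.inr ⟨hc, rfl⟩, rfl⟩, rfl⟩
    simp only [h1, h2]
  · intro D h
    rw [mem_arcSystems] at h
    ext p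
    simp only [mem_addArcs, Finset.mem_image, Finset.mem_filter]
    constructor
    · rintro (hp | ⟨⟨q, hq, hqp⟩, hp⟩)
      · exact hp.1
      · rw [← Prod.ext hqp (hq.2.trans hp.symm)]
        exact hq.1
    · intro hp
      have := h.1 p hp
      by_cases hpm : p.2 = m
      · exact Or.inr ⟨⟨p, ⟨hp, hpm⟩, rfl⟩, hpm⟩
      · exact Or.inl ⟨hp, by omega⟩

/-- Arc systems on `m` vertices with `e` arcs and `r` marked inner visible vertices; equivalently,
dissections of the `(m + 1)`-gon with `e + r` diagonals, `r` of them at the last vertex. -/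
noncomputable def markedCount (m e r : ℕ) : ℕ :=
  ∑ D ∈ arcSystems m, if D.card = e then (innerVisible m D).card.choose r else 0

/-- A sum over the subsets of `U`, graded by size. -/
theorem sum_powerset_card_eq (U : Finset ℕ) (k e : ℕ) (g : Finset ℕ → ℕ) :
    ∑ C ∈ U.powerset, (if k + C.card = e then g C else 0) =
      ∑ x ∈ Finset.HasAntidiagonal.antidiagonal e,
        if k = x.1 then ∑ C ∈ Finset.powersetCard x.2 U, g C else 0 := by
  rcases le_or_gt k e with h | h
  · rw [Finset.sum_eq_single (k, e - k)]
    · rw [if_pos rfl, Finset.powersetCard_eq_filter, Finset.sum_filter]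
      refine Finset.sum_congr rfl fun C _ => ?_
      congr 1
      exact propext ⟨fun _ => by omega, fun _ => by omega⟩
    · rintro ⟨a, b⟩ hx hne
      rw [Finset.HasAntidiagonal.mem_antidiagonal] at hx
      refine if_neg fun hk => hne ?_
      dsimp only at hx hk
      ext <;> dsimp only <;> omega
    · intro hx
      exact absurd (Finset.HasAntidiagonal.mem_antidiagonal.2 (by dsimp only; omega)) hx
  · rw [Finset.sum_eq_zero, Finset.sum_eq_zero]
    · rintro ⟨a, b⟩ hx
      rw [Finset.HasAntidiagonal.mem_antidiagonal] at hx
      dsimp only at hx ⊢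
      exact if_neg (by omega)
    · exact fun C _ => if_neg (by omega)

theorem markedCount_succ {m : ℕ} (hm : 2 ≤ m) (e r : ℕ) :
    markedCount (m + 1) e r = ∑ x ∈ Finset.HasAntidiagonal.antidiagonal e,
      ∑ D ∈ arcSystems m, if D.card = x.1 then
        ((innerVisible m D).card + 1).choose (x.2 + r) else 0 := by
  rw [markedCount, sum_arcSystems_succ hm, Finset.sum_comm]
  refine Finset.sum_congr rfl fun D hD => ?_
  rw [mem_arcSystems] at hD
  have hW : ∀ w ∈ innerVisible m D, 0 < w ∧ w < m - 1 := fun w hw => (mem_innerVisible.1 hw).1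
  simp only [card_addArcs hD, innerVisible_addArcs hm hD]
  rw [sum_powerset_card_eq]
  simp only [sum_powersetCard_choose_card_le r _ _ (m - 1) hW (by omega)]

/-- Arc systems on `m` vertices with `e - s` arcs and `s + d` marked inner visible vertices, over
all `s ≤ e`; equivalently, dissections of the `(m + 1)`-gon with `e + d` diagonals, at least `d` of
them at the last vertex. -/
noncomputable def degreeGECount (m e d : ℕ) : ℕ :=
  ∑ x ∈ Finset.HasAntidiagonal.antidiagonal e, markedCount m x.1 (x.2 + d)

theorem degreeGECount_zero (m d : ℕ) : degreeGECount m 0 d = markedCount m 0 d := by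
  simp [degreeGECount]

theorem degreeGECount_succ (m e d : ℕ) :
    degreeGECount m (e + 1) d = markedCount m (e + 1) d + degreeGECount m e (d + 1) := by
  rw [degreeGECount, degreeGECount, Finset.Nat.sum_antidiagonal_succ', zero_add]
  simp only [add_assoc, add_comm 1 d]

theorem markedCount_succ_succ {m : ℕ} (hm : 2 ≤ m) (e d : ℕ) :
    markedCount (m + 1) e (d + 1) = degreeGECount m e (d + 1) + degreeGECount m e d := by
  rw [markedCount_succ hm, degreeGECount, degreeGECount, ← Finset.sum_add_distrib]
  refine Finset.sum_congr rfl fun x _ => ?_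
  rw [markedCount, markedCount, ← Finset.sum_add_distrib]
  refine Finset.sum_congr rfl fun D _ => ?_
  split_ifs
  · rw [← add_assoc, Nat.choose_succ_succ', add_comm]
  · rfl

theorem markedCount_succ_zero_zero {m : ℕ} (hm : 2 ≤ m) :
    markedCount (m + 1) 0 0 = degreeGECount m 0 0 := by
  rw [markedCount_succ hm]
  simp [degreeGECount, markedCount]

theorem markedCount_succ_zero {m : ℕ} (hm : 2 ≤ m) (e : ℕ) :
    markedCount (m + 1) (e + 1) 0 = degreeGECount m (e + 1) 0 + degreeGECount m e 0 := by
  rw [markedCount_succ hm, degreeGECount, degreeGECount, Finset.Nat.sum_antidiagonal_succ',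
    Finset.Nat.sum_antidiagonal_succ', add_assoc, ← Finset.sum_add_distrib]
  congr 1
  · simp [markedCount]
  · refine Finset.sum_congr rfl fun x _ => ?_
    rw [markedCount, markedCount, ← Finset.sum_add_distrib]
    refine Finset.sum_congr rfl fun D _ => ?_
    split_ifs
    · rw [add_zero, add_zero, Nat.choose_succ_succ', add_comm]
    · rfl

theorem arcSystems_two : arcSystems 2 = {∅} := by
  ext D
  rw [mem_arcSystems, Finset.mem_singleton]
  constructor
  · intro h
    refine Finset.eq_empty_of_forall_notMem fun p hp => ?_
    have := h.1 p hp
    omega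
  · rintro rfl
    simp [IsArcSystem]

theorem markedCount_two (e r : ℕ) : markedCount 2 e r = if e = 0 ∧ r = 0 then 1 else 0 := by
  have h : innerVisible 2 ∅ = ∅ := by simp [innerVisible]
  rw [markedCount, arcSystems_two, Finset.sum_singleton, h]
  rcases e with _ | e <;> rcases r with _ | r <;> simp

theorem degreeGECount_two (e d : ℕ) : degreeGECount 2 e d = if e = 0 ∧ d = 0 then 1 else 0 := by
  induction e generalizing d with
  | zero => rw [degreeGECount_zero, markedCount_two]
  | succ e ih => simp [degreeGECount_succ, markedCount_two, ih]

theorem cast_succ_mul_choose_succ (p j : ℕ) :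
    (p.choose (j + 1) : ℚ) = p.choose j * (p - j) / (j + 1) := by
  rw [eq_div_iff (by positivity)]
  rcases le_or_gt j p with h | h
  · rw [← Nat.cast_sub h]
    exact_mod_cast Nat.choose_succ_right_eq p j
  · simp [Nat.choose_eq_zero_of_lt h, Nat.choose_eq_zero_of_lt (h.trans (Nat.lt_succ_self j))]

theorem cast_choose_add_succ (q e : ℕ) :
    ((q + (e + 1)).choose (e + 1) : ℚ) = (q + e).choose e * (q + e + 1) / (e + 1) := by
  rw [eq_div_iff (by positivity)]
  have := Nat.add_one_mul_choose_eq (q + e) e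
  rw [← add_assoc, mul_comm ((q + e).choose e : ℚ)]
  exact_mod_cast this.symm

theorem cast_choose_succ_add (q e : ℕ) :
    ((q + 1 + e).choose e : ℚ) = (q + e).choose e * (q + e + 1) / (q + 1) := by
  rw [eq_div_iff (by positivity)]
  have := Nat.choose_mul_succ_eq (q + e) e
  rw [show q + e + 1 = q + 1 + e by ring, Nat.add_sub_cancel] at this
  rw [show (q + e + 1 : ℚ) = q + 1 + e by ring]
  exact_mod_cast this.symm

theorem degreeGECount_eq (p e d : ℕ) :
    (degreeGECount (p + 2) e d : ℚ) = (p + 1 + e).choose e / (p + 2) *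
      ((d + 2) * p.choose (e + d) + (d + 1) * p.choose (e + d + 1)) := by
  induction p generalizing e d with
  | zero =>
    rw [degreeGECount_two]
    rcases e with _ | e <;> rcases d with _ | d <;> simp [← add_assoc]
  | succ p ihp =>
    induction e generalizing d with
    | zero =>
      rw [degreeGECount_zero]
      rcases d with _ | d
      · rw [markedCount_succ_zero_zero (by omega), ihp]
        push_cast
        simp
        field_simp
        ring
      · rw [markedCount_succ_succ (by omega)]
        push_cast
        rw [ihp, ihp]
        push_cast [zero_add, Nat.choose_succ_succ' p, cast_succ_mul_choose_succ]
        simp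
        field_simp
        ring
    | succ e ihe =>
      rw [degreeGECount_succ]
      push_cast
      rw [ihe]
      rcases d with _ | d
      · rw [markedCount_succ_zero (by omega)]
        push_cast
        rw [ihp, ihp, show e + (0 + 1) + 1 = e + 1 + 1 by ring,
          show e + 1 + 0 + 1 = e + 1 + 1 by ring,
          show e + (0 + 1) = e + 1 by ring, show e + 1 + 0 = e + 1 by ring, add_zero]
        simp only [Nat.choose_succ_succ' p, cast_choose_add_succ, cast_choose_succ_add,
          cast_succ_mul_choose_succ p (e + 1), cast_succ_mul_choose_succ p e, Nat.cast_add,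
          Nat.cast_one, Nat.cast_zero]
        field_simp
        ring
      · rw [markedCount_succ_succ (by omega)]
        push_cast
        rw [ihp, ihp, show e + (d + 1 + 1) + 1 = e + d + 1 + 1 + 1 by ring,
          show e + 1 + (d + 1) + 1 = e + d + 1 + 1 + 1 by ring,
          show e + (d + 1 + 1) = e + d + 1 + 1 by ring, show e + 1 + (d + 1) = e + d + 1 + 1 by ring,
          show e + 1 + d + 1 = e + d + 1 + 1 by ring, show e + 1 + d = e + d + 1 by ring]
        simp only [Nat.choose_succ_succ' p, cast_choose_add_succ, cast_choose_succ_add,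
          cast_succ_mul_choose_succ p (e + d + 1 + 1), cast_succ_mul_choose_succ p (e + d + 1),
          Nat.cast_add, Nat.cast_one]
        field_simp
        ring

theorem numNonCrossing_eq_card (m i : ℕ) :
    numNonCrossing (m + 1) i =
      ({D ∈ arcSystems (m + 1) | D.card = i ∧ (0, m) ∉ D} : Finset (Finset (ℕ × ℕ))).card := by
  have hinj : Function.Injective (Prod.map Fin.val Fin.val : Fin (m + 1) × Fin (m + 1) → ℕ × ℕ) :=
    Fin.val_injective.prodMap Fin.val_injective
  rw [numNonCrossing, ← Nat.card_eq_finsetCard]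
  refine Nat.card_eq_of_bijective (fun S => ⟨S.1.map ⟨_, hinj⟩, ?_⟩) ⟨?_, ?_⟩
  · obtain ⟨S, hS, hdiag, hcross⟩ := S
    simp only [Finset.mem_filter, mem_arcSystems, Finset.card_map, hS, true_and]
    refine ⟨⟨?_, ?_⟩, ?_⟩
    · intro p hp
      obtain ⟨q, hq, rfl⟩ := Finset.mem_map.1 hp
      have h1 := (hdiag q hq).1
      have h2 := (hdiag q hq).2.1
      rw [Fin.lt_def] at h1
      have := q.2.isLt
      simp only [Function.Embedding.coeFn_mk, Prod.map_fst, Prod.map_snd]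
      omega
    · intro p hp q hq
      obtain ⟨p', hp', rfl⟩ := Finset.mem_map.1 hp
      obtain ⟨q', hq', rfl⟩ := Finset.mem_map.1 hq
      exact fun h => hcross p' hp' q' hq' (Or.inl h)
    · intro h
      obtain ⟨p, hp, h⟩ := Finset.mem_map.1 h
      exact (hdiag p hp).2.2 ⟨congrArg Prod.fst h, congrArg Prod.snd h⟩
  · intro S T h
    exact Subtype.ext (Finset.map_injective _ (congrArg Subtype.val h))
  · rintro ⟨D, hD⟩
    simp only [Finset.mem_filter, mem_arcSystems] at hD
    obtain ⟨hD, hcard, h0⟩ := hD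
    have hmap : (D.preimage (Prod.map Fin.val Fin.val) hinj.injOn :
        Finset (Fin (m + 1) × Fin (m + 1))).map ⟨_, hinj⟩ = D := by
      ext p
      simp only [Finset.mem_map, Finset.mem_preimage, Function.Embedding.coeFn_mk]
      constructor
      · rintro ⟨q, hq, rfl⟩
        exact hq
      · intro hp
        have := hD.1 p hp
        exact ⟨(⟨p.1, by omega⟩, ⟨p.2, by omega⟩), hp, rfl⟩
    refine ⟨⟨D.preimage (Prod.map Fin.val Fin.val) hinj.injOn, ?_, ?_, ?_⟩, Subtype.ext hmap⟩
    · rw [← Finset.card_map ⟨_, hinj⟩, hmap, hcard]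
    · intro p hp
      rw [Finset.mem_preimage] at hp
      have := hD.1 _ hp
      simp only [Prod.map_fst, Prod.map_snd] at this
      refine ⟨Fin.lt_def.2 (by omega), by omega, fun h => h0 ?_⟩
      rwa [show ((0, m) : ℕ × ℕ) = Prod.map Fin.val Fin.val p from Prod.ext h.1.symm h.2.symm]
    · intro p hp q hq h
      rw [Finset.mem_preimage] at hp hq
      exact h.elim (hD.2 _ hp _ hq) (hD.2 _ hq _ hp)

theorem numNonCrossing_eq_degreeGECount {m : ℕ} (hm : 2 ≤ m) (i : ℕ) :
    numNonCrossing (m + 1) i = degreeGECount m i 0 := by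
  rw [numNonCrossing_eq_card, Finset.card_filter, sum_arcSystems_succ hm, degreeGECount]
  simp only [markedCount]
  rw [Finset.sum_comm]
  refine Finset.sum_congr rfl fun D hD => ?_
  rw [mem_arcSystems] at hD
  have h0 : 0 ∉ innerVisible m D := fun h => by
    have := (mem_innerVisible.1 h).1
    omega
  have hmD : (0, m) ∉ D := fun h => (hD.1 _ h).2.false
  rw [Finset.sum_powerset_insert h0]
  simp only [mem_addArcs, hmD, card_addArcs hD, Finset.mem_insert_self, false_or, and_self,
    not_true_eq_false, and_false, if_false, Finset.sum_const_zero, add_zero, and_true]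
  have h : ∀ C ∈ (innerVisible m D).powerset,
      (if D.card + C.card = i ∧ 0 ∉ C then 1 else 0) = if D.card + C.card = i then 1 else 0 :=
    fun C hC => if_congr (and_iff_left fun h => h0 (Finset.mem_powerset.1 hC h)) rfl rfl
  rw [Finset.sum_congr rfl h, sum_powerset_card_eq]
  simp

/-- Cayley's formula: for a convex `n`-gon (`n ≥ 3`), the number of sets of `i` pairwise
non-crossing diagonals equals `(1/(i+1)) · C(n-3, i) · C(n+i-1, i)`. -/
theorem stmt_16 (n i : ℕ) (hn : 3 ≤ n) :
    (numNonCrossing n i : ℚ) =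
      (1 / (i + 1 : ℚ)) * (Nat.choose (n - 3) i) * (Nat.choose (n + i - 1) i) := by
  obtain ⟨p, rfl⟩ := Nat.exists_eq_add_of_le' hn
  rw [numNonCrossing_eq_degreeGECount (by omega), degreeGECount_eq, Nat.add_sub_cancel,
    show p + 3 + i - 1 = p + 1 + 1 + i by omega, cast_choose_succ_add (p + 1) i, add_zero,
    cast_succ_mul_choose_succ]
  push_cast
  field_simp
  ring
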